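/- Fix ν ∈ ℝ and set A = 2(ν+1)M₁ − 2M₂, B = ½(2ν+1)(2ν+3)L − R₁ − (4ν+3)R₂, C = L, D = M₁, where L, M₁, M₂, R₁, R₂ are the S-Heun operators on the discrete linear grid. Then in this realization the two Casimir elements take scalar values: Ω₁ := D² − C² equals the identity operator, and Ω₂ := A² + D² − {B,C} equals (2ν+3)² times the identity operator (as operators acting on all functions f : ℝ → ℝ). -/

import Mathlib

/-- Lowering S-Heun operator `L = ½(T₊ − T₋)` on the discrete linear grid. -/
noncomputable def opL (f : ℝ → ℝ) : ℝ → ℝ := fun x => (f (x+1) - f (x-1)) / 2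
/-- Stabilizing S-Heun operator `M₁ = ½(T₊ + T₋)`. -/
noncomputable def opM1 (f : ℝ → ℝ) : ℝ → ℝ := fun x => (f (x+1) + f (x-1)) / 2
/-- Stabilizing S-Heun operator `M₂ = ½ x (T₊ − T₋)`. -/
noncomputable def opM2 (f : ℝ → ℝ) : ℝ → ℝ := fun x => x * (f (x+1) - f (x-1)) / 2
/-- Raising S-Heun operator `R₁ = ½ x [(1−2x)T₊ + (1+2x)T₋]`. -/
noncomputable def opR1 (f : ℝ → ℝ) : ℝ → ℝ :=
  fun x => x * ((1 - 2*x) * f (x+1) + (1 + 2*x) * f (x-1)) / 2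
/-- Raising S-Heun operator `R₂ = ½ x (T₊ + T₋)`. -/
noncomputable def opR2 (f : ℝ → ℝ) : ℝ → ℝ := fun x => x * (f (x+1) + f (x-1)) / 2

/-- `A = 2(ν+1)M₁ − 2M₂`. -/
noncomputable def sklA (ν : ℝ) (f : ℝ → ℝ) : ℝ → ℝ :=
  fun x => 2*(ν+1) * opM1 f x - 2 * opM2 f x
/-- `B = ½(2ν+1)(2ν+3)L − R₁ − (4ν+3)R₂`. -/
noncomputable def sklB (ν : ℝ) (f : ℝ → ℝ) : ℝ → ℝ :=
  fun x => (1/2)*(2*ν+1)*(2*ν+3) * opL f x - opR1 f x - (4*ν+3) * opR2 f x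
/-- `C = L`. -/
noncomputable def sklC (f : ℝ → ℝ) : ℝ → ℝ := opL f
/-- `D = M₁`. -/
noncomputable def sklD (f : ℝ → ℝ) : ℝ → ℝ := opM1 f

/-- In the realization the Casimirs `Ω₁ = D² − C²` and `Ω₂ = A² + D² − {B,C}` take the
scalar values `1` and `(2ν+3)²`. -/
theorem stmt_7 (ν : ℝ) :
    (∀ (f : ℝ → ℝ) (x : ℝ), sklD (sklD f) x - sklC (sklC f) x = f x) ∧
    (∀ (f : ℝ → ℝ) (x : ℝ),
      sklA ν (sklA ν f) x + sklD (sklD f) x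
        - (sklB ν (sklC f) x + sklC (sklB ν f) x) = (2*ν+3)^2 * f x) := by
  have key : ∀ x : ℝ, x + 1 - 1 = x ∧ x - 1 + 1 = x := fun x => by constructor <;> ring
  constructor
  · intro f x
    simp only [sklD, sklC, opM1, opL, (key x).1, (key x).2]
    ring
  · intro f x
    simp only [sklA, sklB, sklD, sklC, opM1, opM2, opR1, opR2, opL, (key x).1, (key x).2]
    ring
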